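/- In the standing setup, assume in addition that k is algebraically closed and let U := span{ℓ_{xx} : x ∈ V} ⊆ V*. If dim U = 1, then R commutes with ζ⊗ζ, i.e. (ζ⊗ζ)∘R = R∘(ζ⊗ζ). -/

import Mathlib

open TensorProduct LinearMap

noncomputable section

variable (k V : Type) [Field k] [AddCommGroup V] [Module k V]

/-- `R ⊗ Id` acting on `V ⊗ (V ⊗ V)`. -/
def op12 (R : V ⊗[k] V →ₗ[k] V ⊗[k] V) :
    V ⊗[k] (V ⊗[k] V) →ₗ[k] V ⊗[k] (V ⊗[k] V) :=
  (TensorProduct.assoc k V V V).toLinearMap ∘ₗ LinearMap.rTensor V R ∘ₗ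
    (TensorProduct.assoc k V V V).symm.toLinearMap

/-- `Id ⊗ R` acting on `V ⊗ (V ⊗ V)`. -/
def op23 (R : V ⊗[k] V →ₗ[k] V ⊗[k] V) :
    V ⊗[k] (V ⊗[k] V) →ₗ[k] V ⊗[k] (V ⊗[k] V) :=
  LinearMap.lTensor V R

/-- A Hecke symmetry with parameter `q`: an operator on `V ⊗ V` satisfying the braid
equation and the Hecke relation `(R - q·Id)(R + Id) = 0`, with `q ≠ 0`. -/
def IsHeckeSymmetry (q : k) (R : V ⊗[k] V →ₗ[k] V ⊗[k] V) : Prop :=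
  q ≠ 0 ∧
    op12 k V R ∘ₗ op23 k V R ∘ₗ op12 k V R = op23 k V R ∘ₗ op12 k V R ∘ₗ op23 k V R ∧
    (R - q • LinearMap.id) ∘ₗ (R + LinearMap.id) = 0

/-- `x ⋏ y = ζ(x) ⊗ y - ζ(y) ⊗ x`. -/
def wedge2 (ζ : V ≃ₗ[k] V) (x y : V) : V ⊗[k] V := ζ x ⊗ₜ[k] y - ζ y ⊗ₜ[k] x

/-- `Υ²`, the span of the tensors `x ⋏ y`. -/
def Ups2 (ζ : V ≃ₗ[k] V) : Submodule k (V ⊗[k] V) :=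
  Submodule.span k {w : V ⊗[k] V | ∃ x y : V, w = wedge2 k V ζ x y}

/-- `x ⋏ y ⋏ z`. -/
def wedge3 (ζ : V ≃ₗ[k] V) (x y z : V) : V ⊗[k] (V ⊗[k] V) :=
  ζ (ζ x) ⊗ₜ[k] (ζ y ⊗ₜ[k] z) + ζ (ζ y) ⊗ₜ[k] (ζ z ⊗ₜ[k] x) + ζ (ζ z) ⊗ₜ[k] (ζ x ⊗ₜ[k] y)
    - ζ (ζ x) ⊗ₜ[k] (ζ z ⊗ₜ[k] y) - ζ (ζ y) ⊗ₜ[k] (ζ x ⊗ₜ[k] z) - ζ (ζ z) ⊗ₜ[k] (ζ y ⊗ₜ[k] x)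

/-- `Υ³`, the span of the tensors `x ⋏ y ⋏ z` (which coincides with
`(V ⊗ Υ²) ∩ (Υ² ⊗ V)`). -/
def Ups3 (ζ : V ≃ₗ[k] V) : Submodule k (V ⊗[k] (V ⊗[k] V)) :=
  Submodule.span k {t : V ⊗[k] (V ⊗[k] V) | ∃ x y z : V, t = wedge3 k V ζ x y z}

/-- The bilinear extension `w ↦ x ⋏ w` of the wedge multiplication `V × Υ² → Υ³`:
on elements of `Υ²` it satisfies `x ⋏ (y ⋏ z) = x ⋏ y ⋏ z`. -/
def wedge31 (ζ : V ≃ₗ[k] V) (x : V) : V ⊗[k] V →ₗ[k] V ⊗[k] (V ⊗[k] V) :=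
  TensorProduct.mk k V (V ⊗[k] V) (ζ (ζ x)) +
    (TensorProduct.assoc k V V V).toLinearMap ∘ₗ
      ((TensorProduct.mk k (V ⊗[k] V) V).flip x ∘ₗ
        TensorProduct.map ζ.toLinearMap ζ.toLinearMap) -
    TensorProduct.map ζ.toLinearMap (TensorProduct.mk k V V (ζ x))

/-- The skewsymmetrizer `Y = q·Id - R`. -/
def skewY (q : k) (R : V ⊗[k] V →ₗ[k] V ⊗[k] V) : V ⊗[k] V →ₗ[k] V ⊗[k] V :=
  q • LinearMap.id - R

/-- `R' = (ζ⁻¹ ⊗ ζ⁻¹) ∘ R ∘ (ζ ⊗ ζ)`. -/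
def Rprime (ζ : V ≃ₗ[k] V) (R : V ⊗[k] V →ₗ[k] V ⊗[k] V) :
    V ⊗[k] V →ₗ[k] V ⊗[k] V :=
  TensorProduct.map ζ.symm.toLinearMap ζ.symm.toLinearMap ∘ₗ R ∘ₗ
    TensorProduct.map ζ.toLinearMap ζ.toLinearMap

/-- `ℓ_{xy}(z) = ω̃(x ⋏ Y(ζ(y) ⊗ z))`, where `Ω` is a linear extension of `ω̃` to
`V ⊗ V ⊗ V`. -/
def ell (ζ : V ≃ₗ[k] V) (Y : V ⊗[k] V →ₗ[k] V ⊗[k] V)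
    (Ω : V ⊗[k] (V ⊗[k] V) →ₗ[k] k) (x y : V) : Module.Dual k V :=
  Ω ∘ₗ wedge31 k V ζ x ∘ₗ Y ∘ₗ TensorProduct.mk k V V (ζ y)

/-- The linear forms `ℓ_{xy}` associated with the Hecke symmetry `R`. -/
def ellF (ζ : V ≃ₗ[k] V) (q : k) (R : V ⊗[k] V →ₗ[k] V ⊗[k] V)
    (Ω : V ⊗[k] (V ⊗[k] V) →ₗ[k] k) (x y : V) : Module.Dual k V :=
  ell k V ζ (skewY k V q R) Ω x y

/-- The linear forms `ℓ'_{xy}` associated with the twisted Hecke symmetry `R'`. -/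
def ellF' (ζ : V ≃ₗ[k] V) (q : k) (R : V ⊗[k] V →ₗ[k] V ⊗[k] V)
    (Ω : V ⊗[k] (V ⊗[k] V) →ₗ[k] k) (x y : V) : Module.Dual k V :=
  ell k V ζ (skewY k V q (Rprime k V ζ R)) Ω x y

/-- The Levi-Civita symbol. -/
def levi (i j m : Fin 3) : k :=
  (![![![0, 0, 0], ![0, 0, 1], ![0, -1, 0]], ![![0, 0, -1], ![0, 0, 0], ![1, 0, 0]],
    ![![0, 1, 0], ![-1, 0, 0], ![0, 0, 0]]] : Fin 3 → Fin 3 → Fin 3 → k) i j m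

variable {k} in
/-- The operator on arrays induced by `Y'` acting on the first two tensor factors. -/
def actL (T : Fin 3 → Fin 3 → Fin 3 → k) (v : Fin 3 → Fin 3 → Fin 3 → k) (i j l : Fin 3) : k :=
  ∑ n, levi k i j n * ∑ a, ∑ b, T n a b * v a b l

variable {k} in
/-- The operator on arrays induced by `Y` acting on the last two tensor factors. -/
def actR (T : Fin 3 → Fin 3 → Fin 3 → k) (v : Fin 3 → Fin 3 → Fin 3 → k) (i j l : Fin 3) : k :=
  ∑ m, levi k j l m * ∑ a, ∑ b, T m a b * v i a b

section HeckeLemmas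

variable {k V}

lemma scalar_of_levi_eq (X Z : Fin 3 → Fin 3 → k)
    (h : ∀ i j l, ∑ n, levi k i j n * X n l = ∑ m, levi k j l m * Z i m) (n l : Fin 3) :
    X n l = (if n = l then Z 0 0 else 0) ∧ Z n l = (if n = l then X 0 0 else 0) := by
  have h1 := h 0 0
  have h2 := h 0 1
  have h3 := h 0 2
  have h4 := h 1 0
  have h5 := h 1 1
  have h6 := h 1 2
  have h7 := h 2 0
  have h8 := h 2 1
  have h9 := h 2 2
  simp [Fin.forall_fin_succ, Fin.sum_univ_three, levi] at h1 h2 h3 h4 h5 h6 h7 h8 h9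
  fin_cases n <;> fin_cases l <;> simp <;> grind

set_option maxHeartbeats 2000000 in
lemma eq_of_scalar {q : k} (hq : q ≠ 0) {T T' : Fin 3 → Fin 3 → Fin 3 → k}
    (hT : ∀ m a b, T m a b - T m b a = (1 + q) * levi k m a b)
    (hT' : ∀ m a b, T' m a b - T' m b a = (1 + q) * levi k m a b)
    (hK : ∀ b, b ≠ 0 → ∀ m a, T m m b = 0 ∧ T m a b = - T a m b)
    (h1 : ∀ r z, ∃ f, ∀ n l, ∑ a, ∑ b, T' n a b *
        actR T (fun i j s => levi k i j r * if s = z then 1 else 0) a b l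
      = q * (if n = r then 1 else 0) * (if l = z then 1 else 0) + if n = l then f else 0) :
    ∀ b, b ≠ 0 → ∀ m a, T' m m b = 0 ∧ T' m a b = - T' a m b := by
  obtain ⟨hK1, hK2⟩ : _ ∧ _ := ⟨hK 1 (by simp), hK 2 (by simp)⟩
  have s0 := hT 0
  have s1 := hT 1
  have s2 := hT 2
  have s0' := hT' 0
  have s1' := hT' 1
  have s2' := hT' 2
  simp [Fin.forall_fin_succ, levi] at hK1 hK2 s0 s1 s2 s0' s1' s2'
  have t001 : T 0 0 1 = 0 := by grind
  have t111 : T 1 1 1 = 0 := by grind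
  have t221 : T 2 2 1 = 0 := by grind
  have t101 : T 1 0 1 = - T 0 1 1 := by grind
  have t021 : T 0 2 1 = - T 2 0 1 := by grind
  have t121 : T 1 2 1 = 0 := by grind
  have t211 : T 2 1 1 = 0 := by grind
  have t002 : T 0 0 2 = 0 := by grind
  have t112 : T 1 1 2 = 0 := by grind
  have t222 : T 2 2 2 = 0 := by grind
  have t102 : T 1 0 2 = - T 0 1 2 := by grind
  have t022 : T 0 2 2 = - T 2 0 2 := by grind
  have t122 : T 1 2 2 = 0 := by grind
  have t212 : T 2 1 2 = 0 := by grind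
  clear hK hK1 hK2 s0 s1 s2 hT hT'
  obtain ⟨f01, e01⟩ := h1 0 1
  obtain ⟨f11, e11⟩ := h1 1 1
  obtain ⟨f21, e21⟩ := h1 2 1
  obtain ⟨f02, e02⟩ := h1 0 2
  obtain ⟨f12, e12⟩ := h1 1 2
  obtain ⟨f22, e22⟩ := h1 2 2
  simp [Fin.forall_fin_succ, Fin.sum_univ_three, levi, actR, t001, t111, t221, t101, t021, t121,
    t211, t002, t112, t222, t102, t022, t122, t212] at e01 e11 e21 e02 e12 e22
  generalize T 2 0 1 = a at *
  generalize T 2 0 2 = b at *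
  generalize T 0 1 1 = c at *
  generalize T 0 1 2 = d at *
  clear h1
  have hdet : a * d - b * c ≠ 0 := by
    intro h
    apply hq
    have : q * q = 0 := by grind
    simpa using this
  have key : ∀ X Y : k, X * a + Y * c = 0 → X * b + Y * d = 0 → X = 0 ∧ Y = 0 := by
    intro X Y h h'
    constructor
    · refine (mul_eq_zero.mp (?_ : (a * d - b * c) * X = 0)).resolve_left hdet
      linear_combination d * h - c * h'
    · refine (mul_eq_zero.mp (?_ : (a * d - b * c) * Y = 0)).resolve_left hdet
      linear_combination a * h' - b * h
  have k0 := key (T' 0 0 1) (T' 0 0 2) (by grind) (by grind)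
  have k1 := key (T' 1 1 1) (T' 1 1 2) (by grind) (by grind)
  have k2 := key (T' 2 2 1) (T' 2 2 2) (by grind) (by grind)
  have k01 := key (T' 0 1 1 + T' 1 0 1) (T' 0 1 2 + T' 1 0 2) (by grind) (by grind)
  have k02 := key (T' 0 2 1 + T' 2 0 1) (T' 0 2 2 + T' 2 0 2) (by grind) (by grind)
  have k12 := key (T' 1 2 1 + T' 2 1 1) (T' 1 2 2 + T' 2 1 2) (by grind) (by grind)
  intro b hb m a
  fin_cases b
  · exact absurd rfl hb
  all_goals fin_cases m <;> fin_cases a <;> simp <;> grind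

set_option maxHeartbeats 2000000 in
lemma eq_of_levi {q : k} (hq : q ≠ 0) {T T' : Fin 3 → Fin 3 → Fin 3 → k}
    (hT : ∀ m a b, T m a b - T m b a = (1 + q) * levi k m a b)
    (hT' : ∀ m a b, T' m a b - T' m b a = (1 + q) * levi k m a b)
    (hK : ∀ b, b ≠ 0 → ∀ m a, T m m b = 0 ∧ T m a b = - T a m b)
    (hK' : ∀ b, b ≠ 0 → ∀ m a, T' m m b = 0 ∧ T' m a b = - T' a m b)
    (h1 : ∀ r z, ∃ f, ∀ n l, ∑ a, ∑ b, T' n a b *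
        actR T (fun i j s => levi k i j r * if s = z then 1 else 0) a b l
      = q * (if n = r then 1 else 0) * (if l = z then 1 else 0) + if n = l then f else 0)
    (hF : ∀ v : Fin 3 → Fin 3 → Fin 3 → k,
      ∑ a, ∑ b, T' 0 a b * actR T (actL T' v) a b 0 - q * ∑ a, ∑ b, T' 0 a b * v a b 0
      = ∑ a, ∑ b, T 0 a b * actL T' (actR T v) 0 a b - q * ∑ a, ∑ b, T 0 a b * v 0 a b) :
    T = T' := by
  have key : ∀ S : Fin 3 → Fin 3 → Fin 3 → k,
      (∀ m a b, S m a b - S m b a = (1 + q) * levi k m a b) →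
      (∀ b, b ≠ 0 → ∀ m a, S m m b = 0 ∧ S m a b = - S a m b) →
      S = ![![![S 0 0 0, 0, 0], ![0, S 0 1 1, 1 + q - S 2 0 1], ![0, - S 2 0 1, - S 2 0 2]],
        ![![S 1 0 0, - S 0 1 1, S 2 0 1 - 1 - q], ![- S 0 1 1, 0, 0], ![S 2 0 1, 0, 0]],
        ![![S 2 0 0, S 2 0 1, S 2 0 2], ![S 2 0 1 - 1 - q, 0, 0], ![S 2 0 2, 0, 0]]] := by
    intro S hS hS'
    obtain ⟨h1, h2⟩ : _ ∧ _ := ⟨hS' 1 (by simp), hS' 2 (by simp)⟩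
    have s0 := hS 0
    have s1 := hS 1
    have s2 := hS 2
    simp [Fin.forall_fin_succ, levi] at h1 h2 s0 s1 s2
    ext m a b
    fin_cases m <;> fin_cases a <;> fin_cases b <;> simp <;> grind
  have e := key T hT hK
  have e' := key T' hT' hK'
  generalize T 2 0 1 = a at e
  generalize T 2 0 2 = b at e
  generalize T 0 1 1 = c at e
  generalize T 0 0 0 = x at e
  generalize T 1 0 0 = y at e
  generalize T 2 0 0 = z at e
  generalize T' 2 0 1 = a' at e'
  generalize T' 2 0 2 = b' at e'
  generalize T' 0 1 1 = c' at e'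
  generalize T' 0 0 0 = x' at e'
  generalize T' 1 0 0 = y' at e'
  generalize T' 2 0 0 = z' at e'
  clear hT hT' hK hK' key
  obtain ⟨f00, e00⟩ := h1 0 0
  obtain ⟨f10, e10⟩ := h1 1 0
  obtain ⟨f20, e20⟩ := h1 2 0
  obtain ⟨f01, e01⟩ := h1 0 1
  obtain ⟨f11, e11⟩ := h1 1 1
  obtain ⟨f21, e21⟩ := h1 2 1
  obtain ⟨f02, e02⟩ := h1 0 2
  obtain ⟨f12, e12⟩ := h1 1 2
  obtain ⟨f22, e22⟩ := h1 2 2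
  have F (j l : Fin 3) := hF (fun a b c => if a = 0 ∧ b = j ∧ c = l then 1 else 0)
  have F11 := F 1 1
  have F12 := F 1 2
  have F21 := F 2 1
  have F22 := F 2 2
  subst e e'
  clear h1 hF F
  simp [Fin.forall_fin_succ, Fin.sum_univ_three, levi, actR] at e01 e11 e21 e02 e12 e22 e00 e10 e20
  simp [Fin.sum_univ_three, levi, actR, actL] at F11 F12 F21 F22
  have d0 : (1 + q - a') * a' - b' * c' = q := by
    by_contra h
    have key : ∀ X, ((1 + q - a') * a' - b' * c' - q) * X = 0 → X = 0 := fun X hX =>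
      (mul_eq_zero.mp hX).resolve_left (sub_ne_zero.mpr h)
    have ha : a = 0 := key a (by grind)
    have hc : c = 0 := key c (by grind)
    apply hq
    grind
  have ha : a = a' := mul_left_cancel₀ hq (by grind)
  have hb : b = b' := mul_left_cancel₀ hq (by grind)
  have hc : c = c' := mul_left_cancel₀ hq (by grind)
  subst ha hb hc
  have hx : x = x' := mul_left_cancel₀ hq (by grind)
  have hy : y = y' := mul_left_cancel₀ hq (by grind)
  have hz : z = z' := mul_left_cancel₀ hq (by grind)
  rw [hx, hy, hz]

lemma scalar_form_of_braid {q : k} {T T' : Fin 3 → Fin 3 → Fin 3 → k}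
    (hb : ∀ v i j l, actL T' (actR T (actL T' v)) i j l - q * actL T' v i j l =
      actR T (actL T' (actR T v)) i j l - q * actR T v i j l)
    (v : Fin 3 → Fin 3 → Fin 3 → k) (n l : Fin 3) :
    ∑ a, ∑ b, T' n a b * actR T (actL T' v) a b l - q * ∑ a, ∑ b, T' n a b * v a b l =
      if n = l then
        ∑ a, ∑ b, T 0 a b * actL T' (actR T v) 0 a b - q * ∑ a, ∑ b, T 0 a b * v 0 a b
      else 0 := by
  refine (scalar_of_levi_eq
    (fun n l => ∑ a, ∑ b, T' n a b * actR T (actL T' v) a b l - q * ∑ a, ∑ b, T' n a b * v a b l)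
    (fun i m => ∑ a, ∑ b, T m a b * actL T' (actR T v) i a b - q * ∑ a, ∑ b, T m a b * v i a b)
    (fun i j l => ?_) n l).1
  simp only [mul_sub, Finset.sum_sub_distrib, mul_left_comm _ q, ← Finset.mul_sum]
  exact hb v i j l

lemma eq_of_braid {q : k} (hq : q ≠ 0) {T T' : Fin 3 → Fin 3 → Fin 3 → k}
    (hT : ∀ m a b, T m a b - T m b a = (1 + q) * levi k m a b)
    (hT' : ∀ m a b, T' m a b - T' m b a = (1 + q) * levi k m a b)
    (hK : ∀ b, b ≠ 0 → ∀ m a, T m m b = 0 ∧ T m a b = - T a m b)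
    (hs : ∀ r, ∃ w : Fin 3 → Fin 3 → k, ∀ n, ∑ a, ∑ b, T' n a b * w a b = if n = r then 1 else 0)
    (hb : ∀ v i j l, actL T' (actR T (actL T' v)) i j l - q * actL T' v i j l =
      actR T (actL T' (actR T v)) i j l - q * actR T v i j l) :
    T = T' := by
  have h1 : ∀ r z, ∃ f, ∀ n l, ∑ a, ∑ b, T' n a b *
        actR T (fun i j s => levi k i j r * if s = z then 1 else 0) a b l
      = q * (if n = r then 1 else 0) * (if l = z then 1 else 0) + if n = l then f else 0 := by
    intro r z
    obtain ⟨w, hw⟩ := hs r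
    let v : Fin 3 → Fin 3 → Fin 3 → k := fun i j s => w i j * if s = z then 1 else 0
    refine ⟨∑ a, ∑ b, T 0 a b * actL T' (actR T v) 0 a b - q * ∑ a, ∑ b, T 0 a b * v 0 a b,
      fun n l => ?_⟩
    have h := scalar_form_of_braid hb v n l
    have e (n l : Fin 3) : ∑ a, ∑ b, T' n a b * (w a b * if l = z then 1 else 0) =
        (if n = r then 1 else 0) * (if l = z then 1 else 0) := by
      rw [← hw n, Finset.sum_mul]
      simp only [Finset.sum_mul, mul_assoc]
    have e' : actL T' v =
        fun i j s => levi k i j r * if s = z then 1 else 0 := by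
      ext i j s
      simp only [actL, v, e]
      simp
    rw [e', show ∑ a, ∑ b, T' n a b * v a b l = _ from e n l, sub_eq_iff_eq_add'] at h
    rw [h, ← mul_assoc]
  refine eq_of_levi hq hT hT' hK (eq_of_scalar hq hT hT' hK h1) h1 fun v => ?_
  simpa using scalar_form_of_braid hb v 0 0

lemma exists_forall_mem_eq_smul {U : Submodule k V} (hU : Module.finrank k U = 1) :
    ∃ v : V, v ≠ 0 ∧ ∀ w ∈ U, ∃ c : k, c • v = w := by
  obtain ⟨v, hv, h⟩ := finrank_eq_one_iff'.mp hU
  refine ⟨v, by simpa using hv, fun w hw => ?_⟩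
  obtain ⟨c, hc⟩ := h ⟨w, hw⟩
  exact ⟨c, congrArg Subtype.val hc⟩

lemma exists_adapted_basis (hdim : Module.finrank k V = 3) {ω : AlternatingMap k V k (Fin 3)}
    (hω : ω ≠ 0) {φ : Module.Dual k V} (hφ : φ ≠ 0) :
    ∃ e : Module.Basis (Fin 3) k V, φ (e 1) = 0 ∧ φ (e 2) = 0 ∧ ω = e.det := by
  have : FiniteDimensional k V := FiniteDimensional.of_finrank_eq_succ hdim
  have hker := Module.Dual.finrank_ker_add_one_of_ne_zero hφ
  let b := Module.finBasisOfFinrankEq k (LinearMap.ker φ) (n := 2) (by omega)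
  obtain ⟨y, hy⟩ : ∃ y, φ y ≠ 0 := by
    by_contra! h
    exact hφ (LinearMap.ext h)
  let e : Module.Basis (Fin 3) k V := Module.Basis.mkFinCons y b
    (fun c x hx h => by
      have := congrArg φ h
      simpa [LinearMap.mem_ker.mp hx, hy] using this)
    (fun z => ⟨-(φ z / φ y), by simp [hy]⟩)
  have hω' := AlternatingMap.eq_smul_basis_det e ω
  have hc : ω e ≠ 0 := fun h => hω (by rw [hω', h, zero_smul])
  refine ⟨e.unitsSMul ![Units.mk0 _ (inv_ne_zero hc), 1, 1], ?_, ?_, ?_⟩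
  · have h : e 1 = (b 0 : V) := by simp [e]
    simp [Module.Basis.unitsSMul_apply, h]
  · have h : e 2 = (b 1 : V) := by
      simpa [e] using Fin.cons_succ (α := fun _ => V) y (Subtype.val ∘ b) 1
    simp [Module.Basis.unitsSMul_apply, h]
  · rw [Module.Basis.det_unitsSMul]
    simpa [Fin.prod_univ_three] using hω'

lemma wedge31_wedge2 (ζ : V ≃ₗ[k] V) (x y z : V) :
    wedge31 k V ζ x (wedge2 k V ζ y z) = wedge3 k V ζ x y z := by
  simp [wedge31, wedge2, wedge3, TensorProduct.tmul_sub]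
  abel

lemma wedge31_add (ζ : V ≃ₗ[k] V) (x y : V) :
    wedge31 k V ζ (x + y) = wedge31 k V ζ x + wedge31 k V ζ y := by
  ext u v
  simp [wedge31, TensorProduct.tmul_add]
  abel

lemma map_wedge2 (ζ f : V ≃ₗ[k] V) (hf : ∀ x, f (ζ x) = ζ (f x)) (x y : V) :
    TensorProduct.map f.toLinearMap f.toLinearMap (wedge2 k V ζ x y) =
      wedge2 k V ζ (f x) (f y) := by
  simp [wedge2, hf]

lemma wedge2_mem (ζ : V ≃ₗ[k] V) (x y : V) : wedge2 k V ζ x y ∈ Ups2 k V ζ :=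
  Submodule.subset_span ⟨x, y, rfl⟩

lemma skewY_comp_self {q : k} {R : V ⊗[k] V →ₗ[k] V ⊗[k] V} (hR : IsHeckeSymmetry k V q R) :
    skewY k V q R ∘ₗ skewY k V q R = (1 + q) • skewY k V q R := by
  ext x y
  have h := congrArg (fun f => f (x ⊗ₜ[k] y)) hR.2.2
  simp [skewY] at h ⊢
  linear_combination (norm := module) h

lemma op12_skewY (q : k) (R : V ⊗[k] V →ₗ[k] V ⊗[k] V) :
    op12 k V (skewY k V q R) = q • LinearMap.id - op12 k V R := by
  ext x y z
  simp [op12, skewY, TensorProduct.smul_tmul']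

lemma op23_skewY (q : k) (R : V ⊗[k] V →ₗ[k] V ⊗[k] V) :
    op23 k V (skewY k V q R) = q • LinearMap.id - op23 k V R := by
  ext x y z
  simp [op23, skewY]

lemma skewY_braid {q : k} {R : V ⊗[k] V →ₗ[k] V ⊗[k] V} (hR : IsHeckeSymmetry k V q R)
    (t : V ⊗[k] (V ⊗[k] V)) :
    op12 k V (skewY k V q R) (op23 k V (skewY k V q R) (op12 k V (skewY k V q R) t)) -
        q • op12 k V (skewY k V q R) t =
      op23 k V (skewY k V q R) (op12 k V (skewY k V q R) (op23 k V (skewY k V q R) t)) -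
        q • op23 k V (skewY k V q R) t := by
  have hb := LinearMap.congr_fun hR.2.1 t
  have hsq : R ∘ₗ R = (q - 1) • R + q • LinearMap.id := by
    have h := hR.2.2
    simp only [LinearMap.comp_add, LinearMap.sub_comp, LinearMap.smul_comp, LinearMap.id_comp,
      LinearMap.comp_id] at h
    linear_combination (norm := module) h
  have h12 : op12 k V R (op12 k V R t) = (q - 1) • op12 k V R t + q • t := by
    have h : op12 k V R ∘ₗ op12 k V R = op12 k V (R ∘ₗ R) := by
      ext x y z
      simp [op12]
    rw [← LinearMap.comp_apply, h, hsq]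
    simp [op12, LinearMap.rTensor_add, LinearMap.rTensor_smul]
  have h23 : op23 k V R (op23 k V R t) = (q - 1) • op23 k V R t + q • t := by
    rw [← LinearMap.comp_apply, op23, ← LinearMap.lTensor_comp, hsq]
    simp [LinearMap.lTensor_add, LinearMap.lTensor_smul]
  simp only [op12_skewY, op23_skewY, LinearMap.comp_apply, LinearMap.sub_apply,
    LinearMap.smul_apply, LinearMap.id_apply, map_sub, map_smul, smul_sub, h12, h23] at hb ⊢
  linear_combination (norm := module) -hb

/-- The basis `ζ(eᵢ) ⊗ eⱼ` of `V ⊗ V`. -/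
def basis2 (ζ : V ≃ₗ[k] V) (e : Module.Basis (Fin 3) k V) :
    Module.Basis (Fin 3 × Fin 3) k (V ⊗[k] V) :=
  (e.map ζ).tensorProduct e

/-- The basis `ζ²(eᵢ) ⊗ ζ(eⱼ) ⊗ eₗ` of `V ⊗ V ⊗ V`. -/
def basis3 (ζ : V ≃ₗ[k] V) (e : Module.Basis (Fin 3) k V) :
    Module.Basis (Fin 3 × Fin 3 × Fin 3) k (V ⊗[k] (V ⊗[k] V)) :=
  ((e.map ζ).map ζ).tensorProduct (basis2 ζ e)

lemma basis2_apply (ζ : V ≃ₗ[k] V) (e : Module.Basis (Fin 3) k V) (i j : Fin 3) :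
    basis2 ζ e (i, j) = ζ (e i) ⊗ₜ[k] e j := by
  simp [basis2]

/-- The coordinates `ℓ_{e_m e_a}(e_b)`. -/
def ellCoord (ζ : V ≃ₗ[k] V) (Y : V ⊗[k] V →ₗ[k] V ⊗[k] V)
    (Ω : V ⊗[k] (V ⊗[k] V) →ₗ[k] k) (e : Module.Basis (Fin 3) k V) (m a b : Fin 3) : k :=
  ell k V ζ Y Ω (e m) (e a) (e b)

lemma sum_ellCoord_mul_repr (ζ : V ≃ₗ[k] V) (Y : V ⊗[k] V →ₗ[k] V ⊗[k] V)
    (Ω : V ⊗[k] (V ⊗[k] V) →ₗ[k] k) (e : Module.Basis (Fin 3) k V) (m : Fin 3) (u : V ⊗[k] V) :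
    ∑ a, ∑ b, ellCoord ζ Y Ω e m a b * (basis2 ζ e).repr u (a, b) =
      Ω (wedge31 k V ζ (e m) (Y u)) := by
  have h := congrArg (fun u => Ω (wedge31 k V ζ (e m) (Y u))) ((basis2 ζ e).sum_repr u)
  simp only [map_sum, map_smul, Fintype.sum_prod_type, basis2_apply, smul_eq_mul] at h
  rw [← h]
  simp [ellCoord, ell, mul_comm]

lemma det_basis_levi (e : Module.Basis (Fin 3) k V) (m a b : Fin 3) :
    e.det ![e m, e a, e b] = levi k m a b := by
  simp only [Module.Basis.det_apply, Matrix.det_fin_three, Module.Basis.toMatrix_apply]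
  fin_cases m <;> fin_cases a <;> fin_cases b <;> simp [levi]

lemma ell_add_add (ζ : V ≃ₗ[k] V) (Y : V ⊗[k] V →ₗ[k] V ⊗[k] V)
    (Ω : V ⊗[k] (V ⊗[k] V) →ₗ[k] k) (x y : V) :
    ell k V ζ Y Ω (x + y) (x + y) = ell k V ζ Y Ω x x + ell k V ζ Y Ω x y +
      ell k V ζ Y Ω y x + ell k V ζ Y Ω y y := by
  ext z
  simp [ell, wedge31_add]
  ring

lemma map_comp_map_symm (ζ : V ≃ₗ[k] V) :
    TensorProduct.map ζ.toLinearMap ζ.toLinearMap ∘ₗ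
      TensorProduct.map ζ.symm.toLinearMap ζ.symm.toLinearMap = LinearMap.id := by
  simp [← TensorProduct.map_comp]

lemma range_Rprime {ζ : V ≃ₗ[k] V} {Y : V ⊗[k] V →ₗ[k] V ⊗[k] V}
    (hY : LinearMap.range Y = Ups2 k V ζ) : LinearMap.range (Rprime k V ζ Y) = Ups2 k V ζ := by
  have hsurj : LinearMap.range (TensorProduct.map ζ.toLinearMap ζ.toLinearMap) = ⊤ :=
    LinearMap.range_eq_top.mpr
      (TensorProduct.map_surjective ζ.surjective ζ.surjective)
  rw [Rprime, LinearMap.range_comp, LinearMap.range_comp, hsurj, Submodule.map_top, hY, Ups2,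
    Submodule.map_span]
  congr 1
  ext w
  constructor
  · rintro ⟨_, ⟨x, y, rfl⟩, rfl⟩
    exact ⟨ζ.symm x, ζ.symm y, map_wedge2 ζ ζ.symm (by simp) x y⟩
  · rintro ⟨x, y, rfl⟩
    exact ⟨_, ⟨ζ x, ζ y, rfl⟩, by simpa using map_wedge2 ζ ζ.symm (by simp) (ζ x) (ζ y)⟩

lemma Rprime_comp_self {ζ : V ≃ₗ[k] V} {c : k} {Y : V ⊗[k] V →ₗ[k] V ⊗[k] V}
    (hYY : Y ∘ₗ Y = c • Y) : Rprime k V ζ Y ∘ₗ Rprime k V ζ Y = c • Rprime k V ζ Y := by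
  ext x y
  have h (t : V ⊗[k] V) := LinearMap.congr_fun (map_comp_map_symm ζ) t
  have h' (t : V ⊗[k] V) := LinearMap.congr_fun hYY t
  simp only [LinearMap.comp_apply, LinearMap.id_apply, LinearMap.smul_apply] at h h'
  simp [Rprime, h, h']

section Coordinates

variable {ζ : V ≃ₗ[k] V} {Ω : V ⊗[k] (V ⊗[k] V) →ₗ[k] k} {e : Module.Basis (Fin 3) k V}
  (hΩ : ∀ x y z : V, Ω (wedge3 k V ζ x y z) = e.det ![x, y, z])

include hΩ

lemma repr_of_mem_Ups2 {w : V ⊗[k] V} (hw : w ∈ Ups2 k V ζ) (j l : Fin 3) :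
    (basis2 ζ e).repr w (j, l) = ∑ m, levi k j l m * Ω (wedge31 k V ζ (e m) w) := by
  induction hw using Submodule.span_induction with
  | mem w hw =>
    obtain ⟨x, y, rfl⟩ := hw
    simp only [wedge31_wedge2, hΩ, Module.Basis.det_apply, Matrix.det_fin_three,
      Module.Basis.toMatrix_apply, Fin.sum_univ_three]
    fin_cases j <;> fin_cases l <;>
      simp [levi, basis2, wedge2, Module.Basis.tensorProduct_repr_tmul_apply] <;> ring
  | zero => simp
  | add x y _ _ hx hy => simp [hx, hy, mul_add, Finset.sum_add_distrib]
  | smul c x _ hx => simp [hx, Finset.mul_sum, mul_left_comm]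

lemma repr_skew_apply {Y : V ⊗[k] V →ₗ[k] V ⊗[k] V} (hY : LinearMap.range Y ≤ Ups2 k V ζ)
    (u : V ⊗[k] V) (j l : Fin 3) :
    (basis2 ζ e).repr (Y u) (j, l) =
      ∑ m, levi k j l m * ∑ a, ∑ b, ellCoord ζ Y Ω e m a b * (basis2 ζ e).repr u (a, b) := by
  rw [repr_of_mem_Ups2 hΩ (hY ⟨u, rfl⟩)]
  congr! 2 with m
  exact (sum_ellCoord_mul_repr ζ Y Ω e m u).symm

lemma ellCoord_skew {q : k} {Y : V ⊗[k] V →ₗ[k] V ⊗[k] V} (hY : LinearMap.range Y = Ups2 k V ζ)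
    (hYY : Y ∘ₗ Y = (1 + q) • Y) (m a b : Fin 3) :
    ellCoord ζ Y Ω e m a b - ellCoord ζ Y Ω e m b a = (1 + q) * levi k m a b := by
  obtain ⟨u, hu⟩ : wedge2 k V ζ (e a) (e b) ∈ LinearMap.range Y := hY ▸ wedge2_mem ζ _ _
  have h : Y (wedge2 k V ζ (e a) (e b)) = (1 + q) • wedge2 k V ζ (e a) (e b) := by
    rw [← hu]
    exact LinearMap.congr_fun hYY u
  have h' := congrArg (fun w => Ω (wedge31 k V ζ (e m) w)) h
  simp only [map_smul, wedge31_wedge2, hΩ, det_basis_levi] at h'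
  simpa [wedge2, ellCoord, ell] using h'

lemma exists_ellCoord_eq_ite {Y : V ⊗[k] V →ₗ[k] V ⊗[k] V} (hY : LinearMap.range Y = Ups2 k V ζ)
    (r : Fin 3) : ∃ w : Fin 3 → Fin 3 → k, ∀ n,
      ∑ a, ∑ b, ellCoord ζ Y Ω e n a b * w a b = if n = r then 1 else 0 := by
  obtain ⟨u, hu⟩ : wedge2 k V ζ (e (r + 1)) (e (r + 2)) ∈ LinearMap.range Y :=
    hY ▸ wedge2_mem ζ _ _
  refine ⟨fun a b => (basis2 ζ e).repr u (a, b), fun n => ?_⟩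
  have h := congrArg (fun w => Ω (wedge31 k V ζ (e n) w)) hu
  simp only [wedge31_wedge2, hΩ, det_basis_levi] at h
  trans levi k n (r + 1) (r + 2)
  · rw [← h]
    exact sum_ellCoord_mul_repr ζ Y Ω e n u
  · fin_cases n <;> fin_cases r <;> simp [levi]

lemma repr_op23 {Y : V ⊗[k] V →ₗ[k] V ⊗[k] V} (hY : LinearMap.range Y ≤ Ups2 k V ζ)
    (t : V ⊗[k] (V ⊗[k] V)) (i j l : Fin 3) :
    (basis3 ζ e).repr (op23 k V Y t) (i, j, l) =
      actR (ellCoord ζ Y Ω e) (fun i j l => (basis3 ζ e).repr t (i, j, l)) i j l := by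
  induction t using TensorProduct.induction_on with
  | zero => simp [actR]
  | tmul x u =>
    simp [op23, actR, basis3, Module.Basis.tensorProduct_repr_tmul_apply, repr_skew_apply hΩ hY,
      Finset.sum_mul, Finset.mul_sum, mul_assoc]
  | add s t hs ht =>
    simp [hs, ht, actR, mul_add, Finset.sum_add_distrib]

lemma repr_op12 {Y : V ⊗[k] V →ₗ[k] V ⊗[k] V}
    (hY : LinearMap.range (Rprime k V ζ Y) ≤ Ups2 k V ζ)
    (t : V ⊗[k] (V ⊗[k] V)) (i j l : Fin 3) :
    (basis3 ζ e).repr (op12 k V Y t) (i, j, l) =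
      actL (ellCoord ζ (Rprime k V ζ Y) Ω e) (fun i j l => (basis3 ζ e).repr t (i, j, l)) i j l := by
  have key (w : V ⊗[k] V) (z : V) (i j l : Fin 3) :
      (basis3 ζ e).repr (TensorProduct.assoc k V V V (w ⊗ₜ[k] z)) (i, j, l) =
        (basis2 ζ e).repr (TensorProduct.map ζ.symm.toLinearMap ζ.symm.toLinearMap w) (i, j) *
          e.repr z l := by
    induction w using TensorProduct.induction_on with
    | zero => simp
    | tmul x y =>
      simp [basis3, basis2, Module.Basis.tensorProduct_repr_tmul_apply]
      ring
    | add s t hs ht => simp [TensorProduct.add_tmul, hs, ht, add_mul]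
  obtain ⟨t, rfl⟩ := (TensorProduct.assoc k V V V).surjective t
  induction t using TensorProduct.induction_on with
  | zero => simp [actL]
  | tmul w z =>
    have h : TensorProduct.map ζ.symm.toLinearMap ζ.symm.toLinearMap (Y w) =
        Rprime k V ζ Y (TensorProduct.map ζ.symm.toLinearMap ζ.symm.toLinearMap w) := by
      have h : w = TensorProduct.map ζ.toLinearMap ζ.toLinearMap
          (TensorProduct.map ζ.symm.toLinearMap ζ.symm.toLinearMap w) := by
        rw [← LinearMap.comp_apply, map_comp_map_symm, LinearMap.id_apply]
      conv_lhs => rw [h]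
      rfl
    simp [op12, key, h, repr_skew_apply hΩ hY, actL, Finset.sum_mul, Finset.mul_sum, mul_assoc]
  | add s t hs ht =>
    simp [hs, ht, actL, mul_add, Finset.sum_add_distrib]

lemma Rprime_eq_self {q : k} (hq : q ≠ 0) {Y : V ⊗[k] V →ₗ[k] V ⊗[k] V}
    (hY : LinearMap.range Y = Ups2 k V ζ) (hYY : Y ∘ₗ Y = (1 + q) • Y)
    (hb : ∀ t, op12 k V Y (op23 k V Y (op12 k V Y t)) - q • op12 k V Y t =
      op23 k V Y (op12 k V Y (op23 k V Y t)) - q • op23 k V Y t)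
    (hK : ∀ b, b ≠ 0 → ∀ x, ell k V ζ Y Ω x x (e b) = 0) :
    Rprime k V ζ Y = Y := by
  have hY' : LinearMap.range (Rprime k V ζ Y) = Ups2 k V ζ := range_Rprime hY
  have hYY' : Rprime k V ζ Y ∘ₗ Rprime k V ζ Y = (1 + q) • Rprime k V ζ Y :=
    Rprime_comp_self hYY
  have h : ellCoord ζ Y Ω e = ellCoord ζ (Rprime k V ζ Y) Ω e := by
    refine eq_of_braid hq (ellCoord_skew hΩ hY hYY) (ellCoord_skew hΩ hY' hYY')
      (fun b hb' m a => ⟨hK b hb' (e m), ?_⟩) (exists_ellCoord_eq_ite hΩ hY') fun v i j l => ?_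
    · have h := hK b hb' (e m + e a)
      rw [ell_add_add] at h
      have h1 := hK b hb' (e m)
      have h2 := hK b hb' (e a)
      simp only [LinearMap.add_apply] at h
      simp only [ellCoord]
      linear_combination h - h1 - h2
    · let t := (basis3 ζ e).equivFun.symm fun p => v p.1 p.2.1 p.2.2
      have ht : (fun i j l => (basis3 ζ e).repr t (i, j, l)) = v := by
        funext i j l
        exact congrFun ((basis3 ζ e).equivFun.apply_symm_apply fun p => v p.1 p.2.1 p.2.2) (i, j, l)
      have h := congrArg (fun s => (basis3 ζ e).repr s (i, j, l)) (hb t)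
      simpa [repr_op12 hΩ hY'.le, repr_op23 hΩ hY.le, ht] using h
  refine (basis2 ζ e).ext fun p => (basis2 ζ e).ext_elem fun r => ?_
  rw [repr_skew_apply hΩ hY'.le _ r.1 r.2, repr_skew_apply hΩ hY.le _ r.1 r.2, h]

end Coordinates

end HeckeLemmas

theorem stmt8 [IsAlgClosed k] (hdim : Module.finrank k V = 3) (ζ : V ≃ₗ[k] V) (q : k)
    (R : V ⊗[k] V →ₗ[k] V ⊗[k] V) (hR : IsHeckeSymmetry k V q R)
    (hY : LinearMap.range (skewY k V q R) = Ups2 k V ζ)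
    (ω : AlternatingMap k V k (Fin 3)) (hω : ω ≠ 0)
    (Ω : V ⊗[k] (V ⊗[k] V) →ₗ[k] k)
    (hΩ : ∀ x y z : V, Ω (wedge3 k V ζ x y z) = ω ![x, y, z])
    (hU : Module.finrank k
      (Submodule.span k {f : Module.Dual k V | ∃ x : V, f = ellF k V ζ q R Ω x x}) = 1) :
    TensorProduct.map ζ.toLinearMap ζ.toLinearMap ∘ₗ R =
      R ∘ₗ TensorProduct.map ζ.toLinearMap ζ.toLinearMap := by
  obtain ⟨φ, hφ, hspan⟩ := exists_forall_mem_eq_smul hU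
  obtain ⟨e, h1, h2, rfl⟩ := exists_adapted_basis hdim hω hφ
  have hK : ∀ b, b ≠ 0 → ∀ x, ell k V ζ (skewY k V q R) Ω x x (e b) = 0 := by
    intro b hb x
    obtain ⟨c, hc⟩ := hspan (ellF k V ζ q R Ω x x) (Submodule.subset_span ⟨x, rfl⟩)
    have hφb : φ (e b) = 0 := by
      fin_cases b
      exacts [absurd rfl hb, h1, h2]
    have h := LinearMap.congr_fun hc (e b)
    simpa [hφb, ellF] using h.symm
  have h := Rprime_eq_self hΩ hR.1 hY (skewY_comp_self hR) (skewY_braid hR) hK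
  have h' : TensorProduct.map ζ.toLinearMap ζ.toLinearMap ∘ₗ skewY k V q R =
      skewY k V q R ∘ₗ TensorProduct.map ζ.toLinearMap ζ.toLinearMap := by
    conv_lhs => rw [← h]
    rw [Rprime, ← LinearMap.comp_assoc, map_comp_map_symm, LinearMap.id_comp]
  simpa [skewY, LinearMap.comp_sub, LinearMap.sub_comp, LinearMap.comp_smul,
    LinearMap.smul_comp] using h'
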